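/- If μ = (μ₁,…,μ_ℓ) is a k-bounded partition with ℓ ≥ 1 and λ = (μ₁,…,μ_{ℓ−1},μ_ℓ−1) is the partition obtained by removing one box from the last (shortest) row of μ (the last part being deleted entirely when μ_ℓ = 1), then λ ≼ μ in the k-Young order. -/

import Mathlib

/-- A partition: a weakly decreasing list of positive integers. -/
def IsPartition (l : List ℕ) : Prop :=
  l.Pairwise (· ≥ ·) ∧ ∀ x ∈ l, 0 < x

/-- The `i`-th part (0-indexed), with parts beyond the length equal to 0. -/
def part (l : List ℕ) (i : ℕ) : ℕ := l.getD i 0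

/-- Diagram containment `l ⊆ m`: every part of `l` is at most the corresponding part of `m`. -/
def SubDiag (l m : List ℕ) : Prop := ∀ i, part l i ≤ part m i

/-- A `k`-bounded partition: a partition whose first part is at most `k`. -/
def KBounded (k : ℕ) (l : List ℕ) : Prop := IsPartition l ∧ part l 0 ≤ k

/-- Hook length of the square `(i,j)` (0-indexed) with respect to the skew diagram
`outer/inner`: the number of cells `(i,j')` of the skew diagram with `j' ≥ j` plus the
number of cells `(i',j)` of the skew diagram with `i' > i`. -/
def hookLen (outer inner : List ℕ) (i j : ℕ) : ℕ :=
  ((Finset.range (part outer i)).filter (fun j' => j ≤ j' ∧ part inner i ≤ j')).card +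
  ((Finset.range outer.length).filter
    (fun i' => i < i' ∧ part inner i' ≤ j ∧ j < part outer i')).card

/-- `(outer, inner)` is the `k`-skew diagram of the `k`-bounded partition `l`:
row `i` of `outer/inner` has `l i` cells, every cell of `outer/inner` has hook length
at most `k`, and every square of the inner shape has hook length exceeding `k`. -/
def IsKSkew (k : ℕ) (l outer inner : List ℕ) : Prop :=
  IsPartition outer ∧ IsPartition inner ∧ SubDiag inner outer ∧
  (∀ i, part outer i - part inner i = part l i) ∧
  (∀ i j, part inner i ≤ j → j < part outer i → hookLen outer inner i j ≤ k) ∧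
  (∀ i j, j < part inner i → k < hookLen outer inner i j)

/-- Length of column `j` of the skew diagram `outer/inner`. -/
def colLen (outer inner : List ℕ) (j : ℕ) : ℕ :=
  ((Finset.range outer.length).filter
    (fun i => part inner i ≤ j ∧ j < part outer i)).card

/-- The list of column lengths of the skew diagram `outer/inner`. -/
def skewCols (outer inner : List ℕ) : List ℕ :=
  ((List.range (part outer 0)).map (colLen outer inner)).filter (fun x => decide (x ≠ 0))

/-- The `k`-conjugate of `l`: the partition whose parts are the column lengths of the
(unique) `k`-skew diagram of `l`. -/
noncomputable def kConj (k : ℕ) (l : List ℕ) : List ℕ :=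
  haveI := Classical.dec (∃ p : List ℕ × List ℕ, IsKSkew k l p.1 p.2)
  if h : ∃ p : List ℕ × List ℕ, IsKSkew k l p.1 p.2 then
    skewCols h.choose.1 h.choose.2
  else []

/-- The covering relation of the `k`-Young order on `k`-bounded partitions. -/
def KCover (k : ℕ) (l m : List ℕ) : Prop :=
  KBounded k l ∧ KBounded k m ∧ SubDiag l m ∧
  SubDiag (kConj k l) (kConj k m) ∧ m.sum = l.sum + 1

/-- The `k`-Young order: reflexive-transitive closure of the covering relation. -/
def KLe (k : ℕ) : List ℕ → List ℕ → Prop := Relation.ReflTransGen (KCover k)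

/-- The weakly decreasing rearrangement of the combined parts of two partitions. -/
def punion (l r : List ℕ) : List ℕ := (l ++ r).mergeSort (fun a b => decide (a ≥ b))

/-- The ordinary conjugate of a partition: the list of column lengths of its diagram. -/
def conj (l : List ℕ) : List ℕ :=
  (List.range (part l 0)).map (fun j => (l.filter (fun x => decide (j < x))).length)

/-- The list of nonzero values among `f 0, …, f (N - 1)`. -/
def trimList (f : ℕ → ℕ) (N : ℕ) : List ℕ :=
  ((List.range N).map f).filter (fun x => decide (x ≠ 0))

lemma exists_trimList_eq {f : ℕ → ℕ} (hf : Antitone f) (N : ℕ) :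
    ∃ M ≤ N, trimList f N = (List.range M).map f ∧ (∀ i < M, f i ≠ 0) ∧
      (M < N → f M = 0) := by
  induction N with
  | zero => exact ⟨0, le_rfl, by simp [trimList], by simp, by simp⟩
  | succ N ih =>
    obtain ⟨M, hMN, hM, hpos, hzero⟩ := ih
    have hsucc : trimList f (N + 1) = trimList f N ++ (if f N = 0 then [] else [f N]) := by
      unfold trimList
      rw [List.range_succ, List.map_append, List.filter_append]
      by_cases h : f N = 0 <;> simp [h]
    by_cases h : f N = 0
    · refine ⟨M, by omega, by simp [hsucc, h, hM], hpos, fun _ => ?_⟩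
      rcases hMN.lt_or_eq with h' | rfl
      · exact hzero h'
      · exact h
    · have hMN' : M = N := by
        by_contra hne
        have h1 := hzero (by omega)
        have h2 := hf hMN
        omega
      subst hMN'
      refine ⟨M + 1, le_rfl, by simp [hsucc, h, hM, List.range_succ], fun i hi => ?_, by simp⟩
      rcases Nat.lt_succ_iff_lt_or_eq.mp hi with h' | rfl
      · exact hpos i h'
      · exact h

lemma part_trimList {f : ℕ → ℕ} (hf : Antitone f) {N : ℕ} (hN : f N = 0) (i : ℕ) :
    part (trimList f N) i = f i := by
  obtain ⟨M, hMN, hM, -, hzero⟩ := exists_trimList_eq hf N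
  have hM0 : f M = 0 := by
    rcases hMN.lt_or_eq with h | rfl
    · exact hzero h
    · exact hN
  rw [hM, part]
  by_cases h : i < M
  · simp [List.getD_eq_getElem?_getD, h]
  · have := hf (not_lt.mp h)
    rw [List.getD_eq_default _ _ (by simpa using h)]
    omega

lemma isPartition_trimList {f : ℕ → ℕ} (hf : Antitone f) (N : ℕ) :
    IsPartition (trimList f N) := by
  refine ⟨List.Pairwise.filter _ ?_, fun x hx => ?_⟩
  · rw [List.pairwise_map]
    exact List.pairwise_lt_range.imp fun h => hf h.le
  · simp only [trimList, List.mem_filter, decide_eq_true_eq] at hx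
    omega

lemma length_trimList_le (f : ℕ → ℕ) (N : ℕ) : (trimList f N).length ≤ N :=
  (List.length_filter_le _ _).trans (by simp)

lemma part_eq_zero {l : List ℕ} {i : ℕ} (h : l.length ≤ i) : part l i = 0 :=
  List.getD_eq_default _ _ h

lemma part_mem {l : List ℕ} {i : ℕ} (h : i < l.length) : part l i ∈ l := by
  rw [part, List.getD_eq_getElem _ _ h]
  exact List.getElem_mem h

lemma IsPartition.part_antitone {l : List ℕ} (h : IsPartition l) : Antitone (part l) := by
  intro i j hij
  rcases hij.lt_or_eq with hij | rfl
  · by_cases hj : j < l.length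
    · rw [part, part, List.getD_eq_getElem _ _ hj, List.getD_eq_getElem _ _ (hij.trans hj)]
      exact List.pairwise_iff_getElem.mp h.1 i j (hij.trans hj) hj hij
    · rw [part_eq_zero (not_lt.mp hj)]
      exact Nat.zero_le _
  · exact le_rfl

lemma IsPartition.part_pos {l : List ℕ} (h : IsPartition l) {i : ℕ} (hi : i < l.length) :
    0 < part l i := h.2 _ (part_mem hi)

lemma KBounded.part_le {k : ℕ} {l : List ℕ} (h : KBounded k l) (i : ℕ) : part l i ≤ k :=
  (h.1.part_antitone (Nat.zero_le i)).trans h.2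

lemma KBounded.le_of_mem {k : ℕ} {l : List ℕ} (h : KBounded k l) {x : ℕ} (hx : x ∈ l) :
    x ≤ k := by
  obtain ⟨i, hi, rfl⟩ := List.getElem_of_mem hx
  have := h.part_le i
  rwa [part, List.getD_eq_getElem _ _ hi] at this

/-- The leftmost position at which a row of `a` cells can be put below a skew diagram with
column lengths `c` so that all its hook lengths are at most `k`. -/
noncomputable def rowShift (k : ℕ) (c : ℕ → ℕ) (a : ℕ) : ℕ := sInf {j | a + c j ≤ k}

/-- The column lengths after putting a row of `a` cells at position `rowShift k c a`. -/
noncomputable def addRow (k a : ℕ) (c : ℕ → ℕ) (j : ℕ) : ℕ :=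
  c j + if rowShift k c a ≤ j ∧ j < rowShift k c a + a then 1 else 0

/-- The column lengths of the `k`-skew diagram of `l`, built by adding rows from the top. -/
noncomputable def kCols (k : ℕ) : List ℕ → ℕ → ℕ
  | [] => 0
  | a :: t => addRow k a (kCols k t)

lemma lt_of_lt_rowShift {k a j : ℕ} {c : ℕ → ℕ} (h : j < rowShift k c a) : k < a + c j :=
  not_le.mp (Nat.notMem_of_lt_sInf (s := {j | a + c j ≤ k}) h)

lemma rowShift_le {k a j : ℕ} {c : ℕ → ℕ} (h : a + c j ≤ k) : rowShift k c a ≤ j :=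
  Nat.sInf_le (s := {j | a + c j ≤ k}) h

lemma add_rowShift_le {k a : ℕ} {c : ℕ → ℕ} (h : ∃ j, a + c j ≤ k) :
    a + c (rowShift k c a) ≤ k :=
  Nat.sInf_mem (s := {j | a + c j ≤ k}) h

lemma exists_forall_kCols_eq_zero (k : ℕ) (l : List ℕ) : ∃ M, ∀ j ≥ M, kCols k l j = 0 := by
  induction l with
  | nil => exact ⟨0, fun _ _ => rfl⟩
  | cons a t ih =>
    obtain ⟨M, hM⟩ := ih
    refine ⟨max M (rowShift k (kCols k t) a + a), fun j hj => ?_⟩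
    have h := hM j (le_trans (le_max_left _ _) hj)
    have h2 := le_trans (le_max_right _ _) hj
    simp only [kCols, addRow, h]
    rw [if_neg (by omega)]

lemma add_kCols_rowShift_le {k a : ℕ} (l : List ℕ) (ha : a ≤ k) :
    a + kCols k l (rowShift k (kCols k l) a) ≤ k := by
  obtain ⟨M, hM⟩ := exists_forall_kCols_eq_zero k l
  exact add_rowShift_le ⟨M, by rw [hM M le_rfl]; omega⟩

lemma kCols_antitone {k : ℕ} {l : List ℕ} (hl : ∀ x ∈ l, x ≤ k) : Antitone (kCols k l) := by
  induction l with
  | nil => exact fun _ _ _ => le_rfl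
  | cons a t ih =>
    have hc := ih fun x hx => hl x (List.mem_cons_of_mem _ hx)
    have hs := add_kCols_rowShift_le t (hl a List.mem_cons_self)
    intro i j hij
    have h1 := hc hij
    simp only [kCols, addRow]
    by_cases hi : i < rowShift k (kCols k t) a
    · have h2 := lt_of_lt_rowShift hi
      by_cases hj : rowShift k (kCols k t) a ≤ j
      · have h3 := hc hj
        split_ifs <;> omega
      · split_ifs <;> omega
    · split_ifs <;> omega

lemma kCols_drop {k : ℕ} (l : List ℕ) (i : ℕ) :
    kCols k (l.drop i) = addRow k (part l i) (kCols k (l.drop (i + 1))) := by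
  by_cases h : i < l.length
  · rw [List.drop_eq_getElem_cons h, part, List.getD_eq_getElem _ _ h, kCols]
  · rw [List.drop_eq_nil_of_le (by omega), List.drop_eq_nil_of_le (by omega),
      part_eq_zero (by omega)]
    funext j
    simp [addRow]

/-- The position of row `i` in the `k`-skew diagram of `l`. -/
noncomputable def rowStart (k : ℕ) (l : List ℕ) (i : ℕ) : ℕ :=
  rowShift k (kCols k (l.drop (i + 1))) (part l i)

lemma add_kCols_rowStart_le {k : ℕ} {l : List ℕ} (hl : KBounded k l) (i : ℕ) :
    part l i + kCols k (l.drop (i + 1)) (rowStart k l i) ≤ k :=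
  add_kCols_rowShift_le _ (hl.part_le i)

lemma rowStart_antitone {k : ℕ} {l : List ℕ} (hl : KBounded k l) : Antitone (rowStart k l) := by
  refine antitone_nat_of_succ_le fun i => rowShift_le ?_
  have h1 := add_kCols_rowStart_le hl i
  have h2 := hl.1.part_antitone (Nat.le_succ i)
  rw [kCols_drop l (i + 1), addRow] at h1
  change part l (i + 1) ≤ _ at h2
  omega

lemma rowStart_eq_zero {k : ℕ} {l : List ℕ} {i : ℕ} (h : l.length ≤ i) :
    rowStart k l i = 0 := by
  refine Nat.le_zero.mp (rowShift_le ?_)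
  rw [part_eq_zero h, List.drop_eq_nil_of_le (by omega)]
  simp [kCols]

/-- The number of cells in column `j` lying in row `i` or above, among the first `N` rows. -/
def colLenFrom (outer inner : List ℕ) (N i j : ℕ) : ℕ :=
  ((Finset.range N).filter
    (fun i' => i ≤ i' ∧ part inner i' ≤ j ∧ j < part outer i')).card

lemma filter_range_length_eq {outer inner : List ℕ} {N : ℕ} (hN : outer.length ≤ N)
    (i j : ℕ) :
    (Finset.range outer.length).filter
        (fun i' => i ≤ i' ∧ part inner i' ≤ j ∧ j < part outer i') =
      (Finset.range N).filter
        (fun i' => i ≤ i' ∧ part inner i' ≤ j ∧ j < part outer i') := by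
  ext x
  simp only [Finset.mem_filter, Finset.mem_range]
  refine ⟨fun h => ⟨by omega, h.2⟩, fun h => ⟨?_, h.2⟩⟩
  by_contra hx
  have := part_eq_zero (not_lt.mp hx)
  omega

lemma colLen_eq_colLenFrom {outer inner : List ℕ} {N : ℕ} (hN : outer.length ≤ N) (j : ℕ) :
    colLen outer inner j = colLenFrom outer inner N 0 j := by
  rw [colLenFrom, ← filter_range_length_eq hN]
  simp [colLen]

lemma hookLen_eq {outer inner : List ℕ} {N : ℕ} (hN : outer.length ≤ N) (i j : ℕ) :
    hookLen outer inner i j =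
      (part outer i - max j (part inner i)) + colLenFrom outer inner N (i + 1) j := by
  rw [hookLen, colLenFrom, ← filter_range_length_eq hN]
  congr 1
  rw [← Nat.card_Ico]
  congr 1
  ext x
  simp only [Finset.mem_filter, Finset.mem_range, Finset.mem_Ico, max_le_iff]
  omega

lemma colLenFrom_succ {outer inner : List ℕ} {N i : ℕ} (hi : i < N) (j : ℕ) :
    colLenFrom outer inner N i j = colLenFrom outer inner N (i + 1) j +
      if part inner i ≤ j ∧ j < part outer i then 1 else 0 := by
  have hdisj : (Finset.range N).filter
      (fun i' => i ≤ i' ∧ part inner i' ≤ j ∧ j < part outer i') =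
      (Finset.range N).filter
        (fun i' => i + 1 ≤ i' ∧ part inner i' ≤ j ∧ j < part outer i') ∪
      (if part inner i ≤ j ∧ j < part outer i then {i} else ∅) := by
    ext x
    by_cases hx : x = i
    · subst hx
      split_ifs with h <;> simp [h, hi]
    · split_ifs <;> simp [hx] <;> omega
  rw [colLenFrom, hdisj, Finset.card_union_of_disjoint]
  · rw [colLenFrom]
    split_ifs <;> simp
  · split_ifs <;> simp

/-- The column lengths are determined by the row positions, provided each row position is
determined by the rows above it. -/
lemma colLenFrom_eq_kCols {k : ℕ} {l outer inner : List ℕ}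
    (hrow : ∀ i, part outer i = part inner i + part l i)
    (hstart : ∀ i < l.length,
      colLenFrom outer inner l.length (i + 1) = kCols k (l.drop (i + 1)) →
        part inner i = rowStart k l i)
    {i : ℕ} (hi : i ≤ l.length) :
    colLenFrom outer inner l.length i = kCols k (l.drop i) := by
  induction hi using Nat.decreasingInduction with
  | self =>
    funext j
    rw [List.drop_length, kCols, colLenFrom, Finset.card_eq_zero.mpr]
    · rfl
    · ext x
      simp only [Finset.mem_filter, Finset.mem_range, Finset.notMem_empty, iff_false]
      omega
  | of_succ i hi ih =>
    funext j
    rw [colLenFrom_succ hi, ih, kCols_drop l i, addRow, hrow i, hstart i hi ih]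
    rfl

lemma IsKSkew.part_outer {k : ℕ} {l outer inner : List ℕ} (h : IsKSkew k l outer inner)
    (i : ℕ) : part outer i = part inner i + part l i := by
  have h1 := h.2.2.1 i
  have h2 := h.2.2.2.1 i
  omega

lemma IsKSkew.length_outer_le {k : ℕ} {l outer inner : List ℕ}
    (h : IsKSkew k l outer inner) : outer.length ≤ l.length := by
  by_contra! hlt
  have hrow := h.part_outer (outer.length - 1)
  rw [part_eq_zero (l := l) (by omega), add_zero] at hrow
  have hpos := h.1.part_pos (i := outer.length - 1) (by omega)
  have hhook := h.2.2.2.2.2 (outer.length - 1) (part inner (outer.length - 1) - 1) (by omega)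
  have hleg : colLenFrom outer inner outer.length (outer.length - 1 + 1)
      (part inner (outer.length - 1) - 1) = 0 := by
    rw [colLenFrom, Finset.card_eq_zero]
    ext x
    simp only [Finset.mem_filter, Finset.mem_range, Finset.notMem_empty, iff_false]
    omega
  rw [hookLen_eq le_rfl, hleg] at hhook
  omega

lemma IsKSkew.colLen_eq {k : ℕ} {l outer inner : List ℕ} (hl : IsPartition l)
    (h : IsKSkew k l outer inner) : colLen outer inner = kCols k l := by
  funext j
  rw [colLen_eq_colLenFrom h.length_outer_le,
    colLenFrom_eq_kCols h.part_outer (fun i hi hc => ?_) (Nat.zero_le _), List.drop_zero]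
  have hrow := h.part_outer i
  have hpos := hl.part_pos hi
  have hcell := h.2.2.2.2.1 i (part inner i) le_rfl (by omega)
  rw [hookLen_eq h.length_outer_le, hc] at hcell
  refine le_antisymm (not_lt.mp fun hlt => ?_) (rowShift_le ?_)
  · have hsq := h.2.2.2.2.2 i _ hlt
    rw [hookLen_eq h.length_outer_le, hc, max_eq_right hlt.le] at hsq
    have := add_rowShift_le (k := k) (a := part l i) (c := kCols k (l.drop (i + 1)))
      ⟨part inner i, by rw [max_self] at hcell; omega⟩
    rw [rowStart] at hsq
    omega
  · rw [max_self] at hcell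
    omega

lemma exists_isKSkew {k : ℕ} {l : List ℕ} (hl : KBounded k l) :
    ∃ p : List ℕ × List ℕ, IsKSkew k l p.1 p.2 := by
  have hanti := rowStart_antitone hl
  have hanti' : Antitone fun i => rowStart k l i + part l i :=
    hanti.add hl.1.part_antitone
  have hin := part_trimList hanti (rowStart_eq_zero (k := k) (le_refl l.length))
  have hout := part_trimList hanti' (N := l.length)
    (by simp [rowStart_eq_zero, part_eq_zero])
  have hlen := length_trimList_le (fun i => rowStart k l i + part l i) l.length
  refine ⟨(trimList (fun i => rowStart k l i + part l i) l.length,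
    trimList (rowStart k l) l.length), isPartition_trimList hanti' _,
    isPartition_trimList hanti _, fun i => ?_, fun i => ?_, fun i j hij hj => ?_,
    fun i j hj => ?_⟩
  · rw [hin, hout]
    omega
  · rw [hin, hout]
    omega
  all_goals
    dsimp only at *
    have hi : i < l.length := by
      by_contra! hi
      simp [hin, hout, rowStart_eq_zero hi, part_eq_zero hi] at hj
    rw [hookLen_eq hlen, colLenFrom_eq_kCols (k := k) (fun i => by rw [hin, hout])
      (fun i _ _ => hin i) (i := i + 1) hi, hin, hout]
    rw [hin] at *
  · have h1 := add_kCols_rowStart_le hl i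
    have h2 := kCols_antitone (k := k) (l := l.drop (i + 1))
      (fun x hx => hl.le_of_mem (List.mem_of_mem_drop hx)) hij
    omega
  · have := lt_of_lt_rowShift hj
    omega

lemma part_kConj {k : ℕ} {l : List ℕ} (hl : KBounded k l) (i : ℕ) :
    part (kConj k l) i = kCols k l i := by
  have h := exists_isKSkew hl
  rw [kConj, dif_pos h]
  have hcol := h.choose_spec.colLen_eq hl.1
  have hanti := kCols_antitone (k := k) (l := l) fun x hx => hl.le_of_mem hx
  change part (trimList _ _) i = _
  rw [hcol]
  refine part_trimList hanti ?_ i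
  rw [← hcol, colLen, Finset.card_eq_zero]
  ext x
  have := h.choose_spec.1.part_antitone (Nat.zero_le x)
  simp only [Finset.mem_filter, Finset.notMem_empty, iff_false]
  omega

/-- If two column-length functions differ by one cell, they still do after adding a row. -/
lemma addRow_eq_add_single {k b : ℕ} {c c' : ℕ → ℕ} (hc : Antitone c)
    (hs : b + c (rowShift k c b) ≤ k) (hs' : b + c' (rowShift k c' b) ≤ k)
    (h : ∃ p, ∀ j, c' j = c j + if j = p then 1 else 0) :
    ∃ p, ∀ j, addRow k b c' j = addRow k b c j + if j = p then 1 else 0 := by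
  obtain ⟨p, hp⟩ := h
  have hle : rowShift k c b ≤ rowShift k c' b := by
    have := hp (rowShift k c' b)
    exact rowShift_le (by omega)
  rcases hle.eq_or_lt with heq | hlt
  · refine ⟨p, fun j => ?_⟩
    rw [addRow, addRow, ← heq, hp]
    omega
  · have h1 := lt_of_lt_rowShift hlt
    have hsp : rowShift k c b = p := by
      by_contra hne
      rw [hp, if_neg hne] at h1
      omega
    have hsucc : rowShift k c' b = rowShift k c b + 1 := by
      refine le_antisymm (rowShift_le ?_) hlt
      rw [hp, if_neg (by omega)]
      have := hc (Nat.le_succ (rowShift k c b))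
      simp only [Nat.succ_eq_add_one] at this
      omega
    refine ⟨p + b, fun j => ?_⟩
    rw [addRow, addRow, hp, hsucc, hsp]
    split_ifs <;> omega

lemma kCols_append_eq_add_single {k a : ℕ} {t : List ℕ} (ht : ∀ x ∈ t, x ≤ k)
    (ha : 0 < a) (hak : a ≤ k) :
    ∃ p, ∀ j, kCols k (t ++ [a]) j =
      kCols k (t ++ if a = 1 then [] else [a - 1]) j + if j = p then 1 else 0 := by
  induction t with
  | nil =>
    refine ⟨a - 1, fun j => ?_⟩
    have hsingle : ∀ b ≤ k, kCols k [b] j = if j < b then 1 else 0 := fun b hb => by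
      have hzero : rowShift k (kCols k []) b = 0 :=
        Nat.le_zero.mp (rowShift_le (by simpa [kCols] using hb))
      change addRow k b (kCols k []) j = _
      rw [addRow, hzero]
      simp [kCols]
    rw [List.nil_append, List.nil_append, hsingle a hak]
    by_cases h1 : a = 1
    · subst h1
      simp [kCols]
    · rw [if_neg h1, hsingle (a - 1) (by omega)]
      split_ifs <;> omega
  | cons b t ih =>
    have hb := ht b List.mem_cons_self
    have ht' : ∀ x ∈ t, x ≤ k := fun x hx => ht x (List.mem_cons_of_mem _ hx)
    simp only [List.cons_append, kCols]
    refine addRow_eq_add_single (kCols_antitone fun x hx => ?_) (add_kCols_rowShift_le _ hb)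
      (add_kCols_rowShift_le _ hb) (ih ht')
    rcases List.mem_append.mp hx with hx | hx
    · exact ht' x hx
    · split_ifs at hx <;> simp at hx
      omega

/-- removing one box from the last (shortest) row of a `k`-bounded
partition `μ` produces a partition `λ` with `λ ≼ μ` in the `k`-Young order. -/
theorem kLe_remove_box_last_row (k : ℕ) (μ : List ℕ) (hμ : KBounded k μ) (hne : μ ≠ []) :
    KLe k (μ.dropLast ++
      (if part μ (μ.length - 1) = 1 then [] else [part μ (μ.length - 1) - 1])) μ := by
  obtain ⟨t, a, rfl⟩ : ∃ t a, μ = t ++ [a] :=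
    ⟨μ.dropLast, μ.getLast hne, (List.dropLast_append_getLast hne).symm⟩
  have hlast : part (t ++ [a]) ((t ++ [a]).length - 1) = a := by simp [part]
  rw [hlast, List.dropLast_concat]
  have ha : 0 < a := hμ.1.2 a (by simp)
  have hsub : SubDiag (t ++ if a = 1 then [] else [a - 1]) (t ++ [a]) := by
    intro i
    simp only [part, List.getD_eq_getElem?_getD]
    rcases lt_trichotomy i t.length with h | rfl | h
    · simp [List.getElem?_append_left h]
    · split_ifs <;> simp
    · rw [List.getElem?_eq_none (by split_ifs <;> simp <;> omega)]
      simp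
  have hlam : KBounded k (t ++ if a = 1 then [] else [a - 1]) := by
    obtain ⟨⟨hpw, hpos⟩, hk⟩ := hμ
    refine ⟨⟨?_, fun x hx => ?_⟩, (hsub 0).trans hk⟩
    · rw [List.pairwise_append] at hpw ⊢
      refine ⟨hpw.1, by split_ifs <;> simp, fun x hx y hy => ?_⟩
      have h1 := hpw.2.2 x hx a (by simp)
      split_ifs at hy <;> simp at hy
      omega
    · rcases List.mem_append.mp hx with hx | hx
      · exact hpos x (by simp [hx])
      · split_ifs at hx <;> simp at hx
        omega
  refine Relation.ReflTransGen.single ⟨hlam, hμ, hsub, fun i => ?_, ?_⟩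
  · rw [part_kConj hlam, part_kConj hμ]
    obtain ⟨p, hp⟩ := kCols_append_eq_add_single (k := k) (t := t)
      (fun x hx => hμ.le_of_mem (by simp [hx])) ha (hμ.le_of_mem (by simp))
    rw [hp i]
    exact Nat.le_add_right _ _
  · split_ifs <;> simp <;> omega
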